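/- arXiv:2604.21595 — 6 statements merged into one kernel-verified Lean document; each statement's English description precedes it below -/
import Mathlib

section
/- Split conformal marginal coverage guarantee (Theorem 3.1, eq. 3.4): Let T ≥ 1 be a natural number and α ∈ (0,1). Let S₁, …, S_{T+1} be real-valued random variables on a probability space (Ω, 𝔽, ℙ) that are exchangeable, i.e. for every permutation σ of {1, …, T+1} the joint law of (S_{σ(1)}, …, S_{σ(T+1)}) equals the joint law of (S₁, …, S_{T+1}). Set m = ⌈(1−α)(T+1)⌉ and assume m ≤ T. Let q̂(ω) denote the m-th smallest value among S₁(ω), …, S_T(ω). Then ℙ(S_{T+1} ≤ q̂) ≥ 1 − α. -/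
open MeasureTheory

/-- In a sorted list, if the `k`-th entry is below `x` then at least `k + 1` entries are. -/
theorem List.SortedLE.lt_countP_of_getElem_lt {l : List ℝ} (hl : l.SortedLE) {k : ℕ}
    (hk : k < l.length) {x : ℝ} (hx : l[k] < x) : k < l.countP (· < x) := by
  have hall : (l.take (k + 1)).countP (· < x) = (l.take (k + 1)).length := by
    rw [List.countP_eq_length]
    intro a ha
    obtain ⟨i, hi, rfl⟩ := List.mem_iff_getElem.1 ha
    rw [List.length_take] at hi
    rw [List.getElem_take]
    exact decide_eq_true ((hl.getElem_le_getElem_of_le (by omega)).trans_lt hx)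
  have hle := (List.take_sublist (k + 1) l).countP_le (p := (· < x))
  rw [hall, List.length_take] at hle
  omega

/-- If fewer than `m` of the values of `f` are below `x`, then `x` is at most the `m`-th smallest
value of `f`. -/
theorem le_getD_sort_ofFn {T m : ℕ} (f : Fin T → ℝ) (hm : 0 < m) (hmT : m ≤ T) {x : ℝ}
    (hx : (Finset.univ.filter fun i => f i < x).card < m) :
    x ≤ (((List.ofFn f : List ℝ) : Multiset ℝ).sort (· ≤ ·)).getD (m - 1) 0 := by
  set l := ((List.ofFn f : List ℝ) : Multiset ℝ).sort (· ≤ ·) with hl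
  have hlen : m - 1 < l.length := by
    rw [hl, Multiset.length_sort, Multiset.coe_card, List.length_ofFn]
    omega
  rw [List.getD_eq_getElem _ _ hlen]
  by_contra! hlt
  have hsorted : l.SortedLE := (Multiset.pairwise_sort _ _).sortedLE
  have hcount := hsorted.lt_countP_of_getElem_lt hlen hlt
  have heq : l.countP (· < x) = (Finset.univ.filter fun i => f i < x).card := by
    rw [← Multiset.coe_countP, hl, Multiset.sort_eq, ← Fin.univ_val_map, Multiset.countP_map]
    rfl
  omega

/-- At least `m` of the entries of a tuple have fewer than `m` entries strictly below them. -/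
theorem le_card_filter_card_filter_lt {n m : ℕ} (v : Fin n → ℝ) (hm : m ≤ n) :
    m ≤ (Finset.univ.filter fun j =>
      (Finset.univ.filter fun i => v i < v j).card < m).card := by
  have hmono := Tuple.monotone_sort v
  let e : Fin m ↪ Fin n := (Fin.castLEEmb hm).trans (Tuple.sort v).toEmbedding
  calc
    m = (Finset.univ.map e).card := by simp
    _ ≤ _ := by
      refine Finset.card_le_card fun j hj => ?_
      obtain ⟨k, -, rfl⟩ := Finset.mem_map.1 hj
      refine Finset.mem_filter.2 ⟨Finset.mem_univ _, ?_⟩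
      have hsub : (Finset.univ.filter fun i => v i < v (e k)) ⊆
          (Finset.Iio (Fin.castLE hm k)).map (Tuple.sort v).toEmbedding := by
        intro i hi
        refine Finset.mem_map.2 ⟨(Tuple.sort v).symm i, Finset.mem_Iio.2 ?_, by simp⟩
        by_contra! hle
        have h := hmono hle
        simp only [Function.comp_apply, Equiv.apply_symm_apply] at h
        exact absurd (Finset.mem_filter.1 hi).2 (not_lt.2 h)
      have hcard := Finset.card_le_card hsub
      rw [Finset.card_map, Fin.card_Iio] at hcard
      exact hcard.trans_lt k.2

/-- The set of tuples with fewer than `m` entries strictly below the `j`-th one is measurable. -/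
theorem measurableSet_card_filter_lt {n : ℕ} (m : ℕ) (j : Fin n) :
    MeasurableSet {v : Fin n → ℝ | (Finset.univ.filter fun i => v i < v j).card < m} := by
  simp only [Finset.card_filter]
  refine measurableSet_lt (Finset.measurable_sum _ fun i _ => ?_) measurable_const
  exact Measurable.ite (measurableSet_lt (measurable_pi_apply i) (measurable_pi_apply j))
    measurable_const measurable_const

/-- For a permutation-invariant probability law on tuples of length `n`, the event
that fewer than `m` entries lie strictly below the `j`-th one has probability at least `m / n`. -/
theorem le_mul_measure_card_filter_lt {n m : ℕ} (hm : m ≤ n) (μ : Measure (Fin n → ℝ))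
    [IsProbabilityMeasure μ] (hμ : ∀ σ : Equiv.Perm (Fin n), μ.map (fun v i => v (σ i)) = μ)
    (j : Fin n) :
    (m : ENNReal) ≤ n * μ {v | (Finset.univ.filter fun i => v i < v j).card < m} := by
  let A : Fin n → Set (Fin n → ℝ) := fun k =>
    {v | (Finset.univ.filter fun i => v i < v k).card < m}
  have hA : ∀ k, MeasurableSet (A k) := measurableSet_card_filter_lt m
  have hsame : ∀ k, μ (A k) = μ (A j) := by
    intro k
    let σ := Equiv.swap j k
    conv_rhs => rw [← hμ σ]
    rw [Measure.map_apply (by fun_prop) (hA j)]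
    congr 1
    ext v
    have hcard : (Finset.univ.filter fun i => v (σ i) < v k).card =
        (Finset.univ.filter fun i => v i < v k).card :=
      Finset.card_equiv σ (by simp)
    simp only [A, Set.mem_preimage, Set.mem_ofPred_eq, ← hcard]
    simp [σ]
  calc
    (m : ENNReal) = ∫⁻ _, (m : ENNReal) ∂μ := by simp
    _ ≤ ∫⁻ v, ∑ k, (A k).indicator 1 v ∂μ := by
      refine lintegral_mono fun v => ?_
      have hsum : ∑ k, (A k).indicator (1 : (Fin n → ℝ) → ENNReal) v =
          ((Finset.univ.filter fun k =>
            (Finset.univ.filter fun i => v i < v k).card < m).card : ENNReal) := by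
        simp [A, Set.indicator_apply]
      rw [hsum]
      exact Nat.cast_le.2 (le_card_filter_card_filter_lt v hm)
    _ = ∑ k, μ (A k) := by
      rw [lintegral_finsetSum _ fun k _ => measurable_one.indicator (hA k)]
      simp only [lintegral_indicator_one (hA _)]
    _ = n * μ (A j) := by simp [hsame]

/-- Split conformal marginal coverage guarantee: if the scores
`S 1, …, S (T+1)` are exchangeable real-valued random variables and `q̂` is the
`⌈(1-α)(T+1)⌉`-th smallest of the first `T` scores, then
`ℙ(S (T+1) ≤ q̂) ≥ 1 - α`. -/
theorem split_conformal_marginal_coverage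
    (T : ℕ) (hT : 1 ≤ T) (α : ℝ) (hα : α ∈ Set.Ioo (0 : ℝ) 1)
    {Ω : Type*} [MeasurableSpace Ω] (ℙ : Measure Ω) [IsProbabilityMeasure ℙ]
    (S : Fin (T + 1) → Ω → ℝ) (hmeas : ∀ i, Measurable (S i))
    (hexch : ∀ σ : Equiv.Perm (Fin (T + 1)),
      Measure.map (fun ω => fun i => S (σ i) ω) ℙ =
        Measure.map (fun ω => fun i => S i ω) ℙ)
    (m : ℕ) (hm : m = ⌈(1 - α) * ((T : ℝ) + 1)⌉₊) (hmT : m ≤ T)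
    (qhat : Ω → ℝ)
    (hq : ∀ ω, qhat ω =
      (((List.ofFn fun i : Fin T => S i.castSucc ω : List ℝ) : Multiset ℝ).sort
          (· ≤ ·)).getD (m - 1) 0) :
    ENNReal.ofReal (1 - α) ≤ ℙ {ω | S (Fin.last T) ω ≤ qhat ω} := by
  have hpos : 0 < m := by
    rw [hm, Nat.ceil_pos]
    exact mul_pos (sub_pos.2 hα.2) (by positivity)
  have hS : Measurable fun ω i => S i ω := measurable_pi_lambda _ hmeas
  let μ := Measure.map (fun ω i => S i ω) ℙ
  have : IsProbabilityMeasure μ := Measure.isProbabilityMeasure_map hS.aemeasurable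
  have hinv : ∀ σ : Equiv.Perm (Fin (T + 1)), μ.map (fun v i => v (σ i)) = μ := fun σ => by
    rw [Measure.map_map (by fun_prop) hS]
    exact hexch σ
  have hrank := le_mul_measure_card_filter_lt (hmT.trans T.le_succ) μ hinv (Fin.last T)
  rw [Measure.map_apply hS (measurableSet_card_filter_lt m _)] at hrank
  have hsub : (fun ω i => S i ω) ⁻¹' {v | (Finset.univ.filter fun i =>
      v i < v (Fin.last T)).card < m} ⊆ {ω | S (Fin.last T) ω ≤ qhat ω} := by
    intro ω hω
    rw [Set.mem_ofPred_eq, hq]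
    refine le_getD_sort_ofFn _ hpos hmT (lt_of_le_of_lt ?_ hω)
    exact Finset.card_le_card_of_injOn Fin.castSucc (by intro; simp)
      (Fin.castSucc_injective T).injOn
  have hle : ENNReal.ofReal (1 - α) * ((T + 1 : ℕ) : ENNReal) ≤ m := by
    rw [← ENNReal.ofReal_natCast, ← ENNReal.ofReal_natCast,
      ← ENNReal.ofReal_mul (by linarith [hα.2])]
    refine ENNReal.ofReal_le_ofReal ?_
    rw [hm]
    exact_mod_cast Nat.le_ceil _
  have hmul := (hle.trans hrank).trans (mul_le_mul_right (measure_mono hsub) _)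
  rw [mul_comm] at hmul
  exact (ENNReal.mul_le_mul_iff_right (by simp) (ENNReal.natCast_ne_top _)).1 hmul
end

section
/- Computable form of the Multivariate Kernel Score (Proposition 3.1): With the MKS data, let λ > 0 satisfy γ = λ(T−1), and define the empirical covariance operator Ĉ : H → H by Ĉx = (1/(T−1)) Σᵢ₌₁ᵀ ⟨φ̃ᵢ, x⟩ φ̃ᵢ. Then: (i) the matrix K̃ + γI_T is invertible; (ii) for every ψ ∈ H there is a unique w ∈ H with Ĉw + λw = ψ; and (iii) this unique w satisfies ⟨ψ, w⟩ = (1/λ)·(⟨ψ, ψ⟩ − k̃*ᵀ(K̃ + γI_T)⁻¹k̃*). In particular the regularized feature-space Mahalanobis distance ⟨ψ, (Ĉ + λ·id_H)⁻¹ψ⟩ equals (1/λ) times the Multivariate Kernel Score ê. -/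
open Matrix
open scoped RealInnerProductSpace

section RegularizedCovariance

variable {ι H : Type*} [Fintype ι] [NormedAddCommGroup H] [InnerProductSpace ℝ H]

theorem inner_sum_smul_eq_gram_mulVec (φ : ι → H) (b : ι → ℝ) (j : ι) :
    ⟪φ j, ∑ i, b i • φ i⟫ = (gram ℝ φ *ᵥ b) j := by
  simp [inner_sum, inner_smul_right, mulVec, dotProduct, mul_comm]

variable [DecidableEq ι]

theorem isUnit_gram_add_smul_one (φ : ι → H) {γ : ℝ} (hγ : 0 < γ) :
    IsUnit (gram ℝ φ + γ • (1 : Matrix ι ι ℝ)) :=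
  (PosDef.posSemidef_add (posSemidef_gram ℝ φ) (PosDef.one.smul hγ)).isUnit

/-- The solution of the regularized covariance equation in terms of the regularized Gram matrix. -/
theorem covariance_add_smul_eq_iff (φ : ι → H) {s lam : ℝ} (hs : 0 < s) (hlam : 0 < lam)
    (ψ w : H) :
    s⁻¹ • ∑ i, ⟪φ i, w⟫ • φ i + lam • w = ψ ↔
      w = lam⁻¹ • (ψ - ∑ i, ((gram ℝ φ + (lam * s) • (1 : Matrix ι ι ℝ))⁻¹ *ᵥ
        fun j => ⟪φ j, ψ⟫) i • φ i) := by
  have hM := isUnit_gram_add_smul_one φ (mul_pos hlam hs)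
  set M := gram ℝ φ + (lam * s) • (1 : Matrix ι ι ℝ) with hMdef
  have hdet : IsUnit M.det := (isUnit_iff_isUnit_det M).1 hM
  have hMv (v : ι → ℝ) (j : ι) : (M *ᵥ v) j = (gram ℝ φ *ᵥ v) j + lam * s * v j := by
    simp [hMdef, add_mulVec, smul_mulVec]
  constructor
  · intro h
    have hb : M⁻¹ *ᵥ (fun j => ⟪φ j, ψ⟫) = fun i => s⁻¹ * ⟪φ i, w⟫ := by
      have hMb : M *ᵥ (fun i => s⁻¹ * ⟪φ i, w⟫) = fun j => ⟪φ j, ψ⟫ := by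
        funext j
        rw [hMv, ← inner_sum_smul_eq_gram_mulVec, ← h, inner_add_right, inner_smul_right (φ j) w]
        simp only [mul_smul, ← Finset.smul_sum]
        field_simp
      rw [← hMb, mulVec_mulVec, nonsing_inv_mul _ hdet, one_mulVec]
    simp only [hb, mul_smul, ← Finset.smul_sum]
    rw [← h, add_sub_cancel_left, inv_smul_smul₀ hlam.ne']
  · intro h
    set b := M⁻¹ *ᵥ fun j => ⟪φ j, ψ⟫ with hb
    have hMb : M *ᵥ b = fun j => ⟪φ j, ψ⟫ := by
      rw [hb, mulVec_mulVec, mul_nonsing_inv _ hdet, one_mulVec]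
    have hw (j : ι) : ⟪φ j, w⟫ = s * b j := by
      have hj := congrFun hMb j
      rw [hMv] at hj
      rw [h, inner_smul_right, inner_sub_right, inner_sum_smul_eq_gram_mulVec, ← hj]
      field_simp
      ring
    simp only [hw, mul_smul, ← Finset.smul_sum]
    rw [inv_smul_smul₀ hs.ne', h, smul_inv_smul₀ hlam.ne', add_sub_cancel]

end RegularizedCovariance

/-- Computable form of the Multivariate Kernel Score (Proposition 3.1):
with `γ = λ(T-1)`, the matrix `K̃ + γI` is invertible, the regularized
covariance equation `Ĉw + λw = ψ'` has a unique solution for every `ψ'`, and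
for the solution `w` corresponding to the test feature vector `ψ` one has
`⟪ψ, w⟫ = (1/λ)(⟪ψ, ψ⟫ - k̃*ᵀ(K̃ + γI)⁻¹ k̃*)`, i.e. the regularized
feature-space Mahalanobis distance equals `(1/λ)` times the MKS. -/
theorem mks_computable_form
    {H : Type*} [NormedAddCommGroup H] [InnerProductSpace ℝ H] [CompleteSpace H]
    (T : ℕ) (hT : 2 ≤ T) (φ : Fin T → H) (ψ : H)
    (γ lam : ℝ) (hγ : 0 < γ) (hlam : 0 < lam) (hγlam : γ = lam * ((T : ℝ) - 1))
    (Ktil : Matrix (Fin T) (Fin T) ℝ) (hK : ∀ i j, Ktil i j = ⟪φ i, φ j⟫)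
    (kstar : Fin T → ℝ) (hk : ∀ i, kstar i = ⟪ψ, φ i⟫)
    (C : H → H) (hC : ∀ x, C x = ((T : ℝ) - 1)⁻¹ • ∑ i, ⟪φ i, x⟫ • φ i) :
    IsUnit (Ktil + γ • (1 : Matrix (Fin T) (Fin T) ℝ)) ∧
    (∀ ψ' : H, ∃! w : H, C w + lam • w = ψ') ∧
    (∀ w : H, C w + lam • w = ψ →
      ⟪ψ, w⟫ =
        lam⁻¹ * (⟪ψ, ψ⟫ -
          kstar ⬝ᵥ ((Ktil + γ • (1 : Matrix (Fin T) (Fin T) ℝ))⁻¹ *ᵥ kstar))) := by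
  have hs : (0 : ℝ) < (T : ℝ) - 1 := by
    have : (2 : ℝ) ≤ T := by exact_mod_cast hT
    linarith
  obtain rfl : Ktil = gram ℝ φ := by
    ext i j
    exact hK i j
  obtain rfl : kstar = fun i => ⟪φ i, ψ⟫ := by
    ext i
    rw [hk, real_inner_comm]
  subst hγlam
  refine ⟨isUnit_gram_add_smul_one φ hγ, fun ψ' => ?_, fun w hw => ?_⟩
  · simp only [hC, covariance_add_smul_eq_iff φ hs hlam]
    exact existsUnique_eq
  · rw [hC, covariance_add_smul_eq_iff φ hs hlam] at hw
    rw [hw, inner_smul_right, inner_sub_right, inner_sum]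
    simp only [inner_smul_right, dotProduct, real_inner_comm ψ, mul_comm]
end

section
/- Non-negativity of the Multivariate Kernel Score (Proposition 4.3): With the MKS data (γ > 0), the matrix K̃ + γI_T is invertible and ⟨ψ, ψ⟩ − k̃*ᵀ(K̃ + γI_T)⁻¹k̃* ≥ 0; that is, ê_k(ε) ≥ 0 for every test feature vector ψ ∈ H. -/
open Matrix
open scoped RealInnerProductSpace

/-- Regularizing a Gram matrix by a positive multiple of the identity makes it positive definite. -/
theorem posDef_gram_add_smul_one {ι H : Type*} [Fintype ι] [DecidableEq ι]
    [NormedAddCommGroup H] [InnerProductSpace ℝ H] (φ : ι → H) {γ : ℝ} (hγ : 0 < γ) :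
    (gram ℝ φ + γ • (1 : Matrix ι ι ℝ)).PosDef :=
  PosDef.posSemidef_add (posSemidef_gram ℝ φ) (PosDef.one.smul hγ)

/-- If `w` solves the regularized normal equations for `ψ`, then the regularized energy
`k ⬝ᵥ w` explained by `w` is at most `⟪ψ, ψ⟫`. -/
theorem dotProduct_le_inner_self_of_gram_add_smul_one_mulVec {ι H : Type*} [Fintype ι]
    [DecidableEq ι] [NormedAddCommGroup H] [InnerProductSpace ℝ H] (φ : ι → H) (ψ : H)
    {γ : ℝ} (hγ : 0 ≤ γ) {w : ι → ℝ}
    (hw : (gram ℝ φ + γ • (1 : Matrix ι ι ℝ)) *ᵥ w = fun i => ⟪ψ, φ i⟫) :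
    (fun i => ⟪ψ, φ i⟫) ⬝ᵥ w ≤ ⟪ψ, ψ⟫ := by
  have hψ : ⟪ψ, ∑ i, w i • φ i⟫ = (fun i => ⟪ψ, φ i⟫) ⬝ᵥ w := by
    simp [inner_sum, inner_smul_right, dotProduct, mul_comm]
  have hgram : w ⬝ᵥ (gram ℝ φ *ᵥ w) = ⟪∑ i, w i • φ i, ∑ i, w i • φ i⟫ := by
    simpa using star_dotProduct_gram_mulVec (𝕜 := ℝ) φ w w
  have henergy := congrArg (w ⬝ᵥ ·) hw
  simp only [add_mulVec, smul_mulVec, one_mulVec, dotProduct_add, dotProduct_smul,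
    smul_eq_mul, hgram] at henergy
  rw [dotProduct_comm w fun i => ⟪ψ, φ i⟫] at henergy
  have hreg : 0 ≤ γ * (w ⬝ᵥ w) :=
    mul_nonneg hγ (Finset.sum_nonneg fun i _ => mul_self_nonneg (w i))
  have hdist : 0 ≤ ⟪ψ - ∑ i, w i • φ i, ψ - ∑ i, w i • φ i⟫ := real_inner_self_nonneg
  rw [real_inner_sub_sub_self, hψ] at hdist
  linarith

/-- Non-negativity of the Multivariate Kernel Score (Proposition 4.3): with the
MKS data, `K̃ + γI` is invertible and
`⟪ψ, ψ⟫ - k̃*ᵀ(K̃ + γI)⁻¹k̃* ≥ 0`, i.e. `ê_k(ε) ≥ 0` for every test feature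
vector `ψ`. -/
theorem mks_nonneg
    {H : Type*} [NormedAddCommGroup H] [InnerProductSpace ℝ H] [CompleteSpace H]
    (T : ℕ) (hT : 2 ≤ T) (φ : Fin T → H) (ψ : H) (γ : ℝ) (hγ : 0 < γ)
    (Ktil : Matrix (Fin T) (Fin T) ℝ) (hK : ∀ i j, Ktil i j = ⟪φ i, φ j⟫)
    (kstar : Fin T → ℝ) (hk : ∀ i, kstar i = ⟪ψ, φ i⟫) :
    IsUnit (Ktil + γ • (1 : Matrix (Fin T) (Fin T) ℝ)) ∧
    0 ≤ ⟪ψ, ψ⟫ - kstar ⬝ᵥ ((Ktil + γ • (1 : Matrix (Fin T) (Fin T) ℝ))⁻¹ *ᵥ kstar) := by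
  obtain rfl : Ktil = gram ℝ φ := Matrix.ext hK
  obtain rfl : kstar = fun i => ⟪ψ, φ i⟫ := funext hk
  have hunit := (posDef_gram_add_smul_one φ hγ).isUnit
  refine ⟨hunit, sub_nonneg.2 <|
    dotProduct_le_inner_self_of_gram_add_smul_one_mulVec φ ψ hγ.le ?_⟩
  rw [mulVec_mulVec, mul_nonsing_inv _ ((isUnit_iff_isUnit_det _).1 hunit), one_mulVec]
end

section
/- Linear kernel recovery (Proposition 4.4): Let d ≥ 1, T ≥ 2, ε₁, …, ε_T, ε ∈ ℝ^d, λ > 0, and γ = λ(T−1). Set ε̄ = (1/T)Σᵢεᵢ, u = ε − ε̄, let Ẽ ∈ ℝ^{d×T} be the matrix whose i-th column is εᵢ − ε̄, and let Σ̂ = (1/(T−1))Σᵢ(εᵢ−ε̄)(εᵢ−ε̄)ᵀ be the sample covariance. Then ẼᵀẼ + γI_T and Σ̂ + λI_d are invertible, and ‖u‖² − uᵀẼ(ẼᵀẼ + γI_T)⁻¹Ẽᵀu = λ·uᵀ(Σ̂ + λI_d)⁻¹u. That is, for the linear kernel k(x,x') = xᵀx', the Multivariate Kernel Score equals λ times the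 regularized Mahalanobis distance MD(ε) = (ε−ε̄)ᵀ(Σ̂+λI_d)⁻¹(ε−ε̄), so the two scores induce identical conformal prediction regions. -/
open Matrix

/-- A Gram matrix plus a positive multiple of the identity is invertible. -/
theorem isUnit_transpose_mul_self_add_smul_one {m n : Type*} [Fintype m] [Fintype n]
    [DecidableEq n] (E : Matrix m n ℝ) {c : ℝ} (hc : 0 < c) :
    IsUnit (Eᵀ * E + c • (1 : Matrix n n ℝ)) := by
  have hE : (Eᵀ * E).PosSemidef := by
    simpa using Matrix.posSemidef_conjTranspose_mul_self E
  exact (Matrix.PosDef.posSemidef_add hE (Matrix.PosDef.one.smul hc)).isUnit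

/-- The push-through identity, in its regularized form. -/
theorem one_sub_mul_inv_mul_transpose {m n : Type*} [Fintype m] [Fintype n]
    [DecidableEq m] [DecidableEq n] (E : Matrix m n ℝ) {c : ℝ} (hc : 0 < c) :
    1 - E * ((Eᵀ * E + c • (1 : Matrix n n ℝ))⁻¹ * Eᵀ) =
      c • (E * Eᵀ + c • (1 : Matrix m m ℝ))⁻¹ := by
  have hA := (Matrix.isUnit_iff_isUnit_det _).mp (isUnit_transpose_mul_self_add_smul_one E hc)
  have hB : IsUnit (E * Eᵀ + c • (1 : Matrix m m ℝ)).det := by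
    simpa using (Matrix.isUnit_iff_isUnit_det _).mp
      (isUnit_transpose_mul_self_add_smul_one Eᵀ hc)
  set A := Eᵀ * E + c • (1 : Matrix n n ℝ) with hAdef
  set B := E * Eᵀ + c • (1 : Matrix m m ℝ) with hBdef
  have hcomm : B * E = E * A := by
    simp [hAdef, hBdef, Matrix.add_mul, Matrix.mul_add, Matrix.mul_assoc]
  have hmul : B * (1 - E * (A⁻¹ * Eᵀ)) = c • (1 : Matrix m m ℝ) := by
    rw [Matrix.mul_sub, ← Matrix.mul_assoc, hcomm, Matrix.mul_assoc,
      Matrix.mul_nonsing_inv_cancel_left _ _ hA, hBdef]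
    simp
  rw [← Matrix.nonsing_inv_mul_cancel_left _ (1 - E * (A⁻¹ * Eᵀ)) hB, hmul]
  simp

/-- Linear kernel recovery (Proposition 4.4): for the linear kernel, the
Multivariate Kernel Score `‖u‖² - uᵀẼ(ẼᵀẼ + γI_T)⁻¹Ẽᵀu` with `γ = λ(T-1)`
equals `λ` times the regularized Mahalanobis distance
`uᵀ(Σ̂ + λI_d)⁻¹u`, where `u = ε - ε̄` and `Σ̂` is the sample covariance. -/
theorem linear_kernel_recovery
    (d T : ℕ) (hd : 1 ≤ d) (hT : 2 ≤ T)
    (ε : Fin T → Fin d → ℝ) (εtest : Fin d → ℝ)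
    (lam γ : ℝ) (hlam : 0 < lam) (hγ : γ = lam * ((T : ℝ) - 1))
    (εbar : Fin d → ℝ) (hbar : εbar = (T : ℝ)⁻¹ • ∑ i, ε i)
    (u : Fin d → ℝ) (hu : u = εtest - εbar)
    (Etil : Matrix (Fin d) (Fin T) ℝ) (hE : ∀ r i, Etil r i = ε i r - εbar r)
    (Sighat : Matrix (Fin d) (Fin d) ℝ)
    (hSig : Sighat = ((T : ℝ) - 1)⁻¹ • ∑ i, vecMulVec (ε i - εbar) (ε i - εbar)) :
    IsUnit (Etilᵀ * Etil + γ • (1 : Matrix (Fin T) (Fin T) ℝ)) ∧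
    IsUnit (Sighat + lam • (1 : Matrix (Fin d) (Fin d) ℝ)) ∧
    u ⬝ᵥ u - u ⬝ᵥ (Etil *ᵥ
        ((Etilᵀ * Etil + γ • (1 : Matrix (Fin T) (Fin T) ℝ))⁻¹ *ᵥ (Etilᵀ *ᵥ u))) =
      lam * (u ⬝ᵥ ((Sighat + lam • (1 : Matrix (Fin d) (Fin d) ℝ))⁻¹ *ᵥ u)) := by
  have hn : (0 : ℝ) < (T : ℝ) - 1 := by
    have : (2 : ℝ) ≤ T := by exact_mod_cast hT
    linarith
  have hγ_pos : 0 < γ := hγ ▸ mul_pos hlam hn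
  have hcov : Sighat = ((T : ℝ) - 1)⁻¹ • (Etil * Etilᵀ) := by
    rw [hSig]
    congr 1
    ext r s
    simp [Matrix.sum_apply, Matrix.mul_apply, vecMulVec_apply, hE]
  have hscale : Sighat + lam • (1 : Matrix (Fin d) (Fin d) ℝ) =
      ((T : ℝ) - 1)⁻¹ • (Etil * Etilᵀ + γ • (1 : Matrix (Fin d) (Fin d) ℝ)) := by
    rw [hcov, smul_add, smul_smul, hγ]
    congr 2
    field_simp
  have hB : IsUnit (Etil * Etilᵀ + γ • (1 : Matrix (Fin d) (Fin d) ℝ)) := by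
    simpa using isUnit_transpose_mul_self_add_smul_one Etilᵀ hγ_pos
  refine ⟨isUnit_transpose_mul_self_add_smul_one Etil hγ_pos, ?_, ?_⟩
  · rw [hscale]
    exact hB.smul (Units.mk0 _ (inv_ne_zero hn.ne'))
  · have hinv : lam • (Sighat + lam • (1 : Matrix (Fin d) (Fin d) ℝ))⁻¹ =
        γ • (Etil * Etilᵀ + γ • (1 : Matrix (Fin d) (Fin d) ℝ))⁻¹ := by
      have hinv_scale := Matrix.inv_smul' (Etil * Etilᵀ + γ • (1 : Matrix (Fin d) (Fin d) ℝ))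
        (Units.mk0 _ (inv_ne_zero hn.ne')) ((Matrix.isUnit_iff_isUnit_det _).mp hB)
      simp only [Units.smul_def, Units.val_mk0, Units.val_inv_eq_inv_val, inv_inv] at hinv_scale
      rw [hscale, hinv_scale, smul_smul, ← hγ]
    calc
      _ = u ⬝ᵥ ((1 - Etil * ((Etilᵀ * Etil + γ • (1 : Matrix (Fin T) (Fin T) ℝ))⁻¹ *
            Etilᵀ)) *ᵥ u) := by
        simp only [Matrix.sub_mulVec, Matrix.one_mulVec, dotProduct_sub, Matrix.mulVec_mulVec]
      _ = _ := by
        rw [one_sub_mul_inv_mul_transpose Etil hγ_pos, ← hinv, Matrix.smul_mulVec,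
          dotProduct_smul, smul_eq_mul]
end

section
/- Spectral decomposition of the Multivariate Kernel Score (Proposition 4.5): With the MKS data, suppose v₁, …, v_T is an orthonormal basis of ℝ^T with K̃vⱼ = λⱼvⱼ and λⱼ > 0 for all j. Define wⱼ = Σᵢ(vⱼ)ᵢφ̃ᵢ ∈ H, eⱼ = wⱼ/√λⱼ, αⱼ = vⱼᵀk̃*, and the orthogonal residual ψ⊥ = ψ − Σⱼ⟨ψ, eⱼ⟩eⱼ. Then: (i) ⟨wᵢ, wⱼ⟩ = λⱼ·1{i=j}, so the eⱼ are orthonormal in H; (ii) ⟨ψ, eⱼ⟩ = αⱼ/√λⱼ; and (iii) ⟨ψ, ψ⟩ − k̃*ᵀ(K̃ + γI_T)⁻¹k̃* = Σⱼ γ·αⱼ²/(λⱼ(λⱼ + γ)) + ‖ψ⊥‖². -/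
open Matrix
open scoped RealInnerProductSpace

/-- In an orthonormal eigenbasis with nonzero eigenvalues, the quadratic form of the inverse of a
matrix is diagonal with the inverse eigenvalues as coefficients. -/
theorem dotProduct_inv_mulVec_of_orthonormal_eigenbasis {n : Type*} [Fintype n] [DecidableEq n]
    {A : Matrix n n ℝ} {v : n → n → ℝ} {μ : n → ℝ}
    (hv : ∀ i j, v i ⬝ᵥ v j = if i = j then (1 : ℝ) else 0)
    (hA : ∀ j, A *ᵥ v j = μ j • v j) (hμ : ∀ j, μ j ≠ 0) (x : n → ℝ) :
    x ⬝ᵥ (A⁻¹ *ᵥ x) = ∑ j, (v j ⬝ᵥ x) ^ 2 / μ j := by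
  set V : Matrix n n ℝ := Matrix.of v
  have hVV : V * Vᵀ = 1 := by
    ext i j
    rw [Matrix.one_apply, ← hv i j]
    rfl
  have hVV' : Vᵀ * V = 1 := mul_eq_one_comm.mp hVV
  have hAV : A * Vᵀ = Vᵀ * diagonal μ := by
    ext i j
    rw [Matrix.mul_diagonal, mul_comm]
    exact congrFun (hA j) i
  have hinv : A⁻¹ = Vᵀ * (diagonal (fun j => (μ j)⁻¹) * V) := by
    apply Matrix.inv_eq_right_inv
    rw [← Matrix.mul_assoc, hAV, Matrix.mul_assoc, ← Matrix.mul_assoc (diagonal μ),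
      Matrix.diagonal_mul_diagonal]
    simp [hμ, hVV']
  rw [hinv, ← Matrix.mulVec_mulVec, ← Matrix.mulVec_mulVec, Matrix.dotProduct_mulVec,
    Matrix.vecMul_transpose, dotProduct]
  refine Finset.sum_congr rfl fun j _ => ?_
  rw [Matrix.mulVec_diagonal]
  change (v j ⬝ᵥ x) * ((μ j)⁻¹ * (v j ⬝ᵥ x)) = _
  ring

/-- Pythagoras for the residual of the expansion along a finite orthonormal family. -/
theorem Orthonormal.norm_sub_sum_inner_smul_sq {H ι : Type*} [NormedAddCommGroup H]
    [InnerProductSpace ℝ H] [Fintype ι] {e : ι → H} (he : Orthonormal ℝ e) (x : H) :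
    ‖x - ∑ j, ⟪x, e j⟫ • e j‖ ^ 2 = ‖x‖ ^ 2 - ∑ j, ⟪x, e j⟫ ^ 2 := by
  have h₁ : ⟪x, ∑ j, ⟪x, e j⟫ • e j⟫ = ∑ j, ⟪x, e j⟫ ^ 2 := by
    simp [inner_sum, inner_smul_right, sq]
  have h₂ : ‖∑ j, ⟪x, e j⟫ • e j‖ ^ 2 = ∑ j, ⟪x, e j⟫ ^ 2 := by
    rw [← real_inner_self_eq_norm_sq, he.inner_sum]
    simp [sq]
  rw [norm_sub_sq_real, h₁, h₂]
  ring

/-- Spectral decomposition of the Multivariate Kernel Score (Proposition 4.5):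
for an orthonormal eigenbasis `vⱼ` of `K̃` with positive eigenvalues `λⱼ`, the
vectors `wⱼ = Σᵢ(vⱼ)ᵢφ̃ᵢ` satisfy `⟪wᵢ, wⱼ⟫ = λⱼ·1{i=j}`, the normalized
principal components `eⱼ = wⱼ/√λⱼ` satisfy `⟪ψ, eⱼ⟫ = αⱼ/√λⱼ`, and the MKS
decomposes as `Σⱼ γαⱼ²/(λⱼ(λⱼ+γ)) + ‖ψ⊥‖²`. -/
theorem mks_spectral_decomposition
    {H : Type*} [NormedAddCommGroup H] [InnerProductSpace ℝ H] [CompleteSpace H]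
    (T : ℕ) (hT : 2 ≤ T) (φtil : Fin T → H) (ψ : H) (γ : ℝ) (hγ : 0 < γ)
    (Ktil : Matrix (Fin T) (Fin T) ℝ) (hK : ∀ i j, Ktil i j = ⟪φtil i, φtil j⟫)
    (kstar : Fin T → ℝ) (hk : ∀ i, kstar i = ⟪ψ, φtil i⟫)
    (v : Fin T → Fin T → ℝ)
    (hortho : ∀ i j, v i ⬝ᵥ v j = if i = j then (1 : ℝ) else 0)
    (lamv : Fin T → ℝ) (hpos : ∀ j, 0 < lamv j)
    (heig : ∀ j, Ktil *ᵥ v j = lamv j • v j)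
    (w : Fin T → H) (hw : ∀ j, w j = ∑ i, v j i • φtil i)
    (e : Fin T → H) (he : ∀ j, e j = (Real.sqrt (lamv j))⁻¹ • w j)
    (α : Fin T → ℝ) (hα : ∀ j, α j = v j ⬝ᵥ kstar)
    (ψperp : H) (hperp : ψperp = ψ - ∑ j, ⟪ψ, e j⟫ • e j) :
    (∀ i j, ⟪w i, w j⟫ = if i = j then lamv j else 0) ∧
    (∀ j, ⟪ψ, e j⟫ = α j / Real.sqrt (lamv j)) ∧
    ⟪ψ, ψ⟫ - kstar ⬝ᵥ ((Ktil + γ • (1 : Matrix (Fin T) (Fin T) ℝ))⁻¹ *ᵥ kstar) =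
      (∑ j, γ * (α j) ^ 2 / (lamv j * (lamv j + γ))) + ‖ψperp‖ ^ 2 := by
  have hww : ∀ i j, ⟪w i, w j⟫ = if i = j then lamv j else 0 := by
    intro i j
    have hKv : ⟪w i, w j⟫ = v i ⬝ᵥ (Ktil *ᵥ v j) := by
      simp only [hw, sum_inner, inner_sum, real_inner_smul_left, real_inner_smul_right,
        dotProduct, Matrix.mulVec, hK, Finset.mul_sum]
      rw [Finset.sum_comm]
      refine Finset.sum_congr rfl fun a _ => Finset.sum_congr rfl fun b _ => ?_
      ring
    rw [hKv, heig, dotProduct_smul, hortho]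
    simp
  have hψe : ∀ j, ⟪ψ, e j⟫ = α j / Real.sqrt (lamv j) := by
    intro j
    rw [he, hw, hα, real_inner_smul_right, inner_sum, div_eq_inv_mul]
    simp [dotProduct, hk, real_inner_smul_right]
  refine ⟨hww, hψe, ?_⟩
  have hon : Orthonormal ℝ e := by
    rw [orthonormal_iff_ite]
    intro i j
    rw [he, he, real_inner_smul_left, real_inner_smul_right, hww]
    split_ifs with h
    · subst h
      have hs := Real.sqrt_pos.mpr (hpos i)
      field_simp
      exact (Real.sq_sqrt (hpos i).le).symm
    · simp
  have heigγ : ∀ j, (Ktil + γ • (1 : Matrix (Fin T) (Fin T) ℝ)) *ᵥ v j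
      = (lamv j + γ) • v j := by
    intro j
    rw [Matrix.add_mulVec, heig, Matrix.smul_mulVec, Matrix.one_mulVec, add_smul]
  have hne : ∀ j, lamv j + γ ≠ 0 := fun j => (add_pos (hpos j) hγ).ne'
  rw [dotProduct_inv_mulVec_of_orthonormal_eigenbasis hortho heigγ hne, hperp,
    hon.norm_sub_sum_inner_smul_sq, real_inner_self_eq_norm_sq]
  have hsum : ∑ j, γ * (α j) ^ 2 / (lamv j * (lamv j + γ))
      = ∑ j, ⟪ψ, e j⟫ ^ 2 - ∑ j, (v j ⬝ᵥ kstar) ^ 2 / (lamv j + γ) := by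
    rw [← Finset.sum_sub_distrib]
    refine Finset.sum_congr rfl fun j _ => ?_
    rw [hψe, ← hα, div_pow, Real.sq_sqrt (hpos j).le]
    have h₁ := (hpos j).ne'
    have h₂ := hne j
    field_simp
    ring
  rw [hsum]
  ring
end

section
/- Deterministic coupling of empirical CDFs of true and estimated scores (the inequality established in the proof of Lemma B.3): Let T ≥ 1, let e₁, …, e_T and ê₁, …, ê_T be real numbers, and define F̃(x) = (1/T)Σₜ1{eₜ ≤ x} and F̂(x) = (1/T)Σₜ1{êₜ ≤ x}. Let F_e : ℝ → [0,1] be nondecreasing and L-Lipschitz for some L > 0. Then for every η > 0 and every x ∈ ℝ: |F̂(x) − F̃(x)| ≤ 2Lη + (1/η)·(1/T)Σₜ|eₜ − êₜ| + 2·sup_{y∈ℝ}|F̃(y) − F_e(y)|. -/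
/-- The empirical cumulative distribution function of a finite real sample. -/
noncomputable def ecdf {T : ℕ} (e : Fin T → ℝ) (x : ℝ) : ℝ :=
  (T : ℝ)⁻¹ * ∑ t, if e t ≤ x then (1 : ℝ) else 0

lemma ecdf_nonneg {T : ℕ} (e : Fin T → ℝ) (x : ℝ) : 0 ≤ ecdf e x := by
  unfold ecdf
  positivity

lemma ecdf_le_one {T : ℕ} (e : Fin T → ℝ) (x : ℝ) : ecdf e x ≤ 1 := by
  have h : ∑ t, (if e t ≤ x then (1 : ℝ) else 0) ≤ T := by
    calc ∑ t, (if e t ≤ x then (1 : ℝ) else 0) ≤ ∑ _t : Fin T, (1 : ℝ) :=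
          Finset.sum_le_sum fun t _ => by split_ifs <;> norm_num
      _ = T := by simp
  calc ecdf e x ≤ (T : ℝ)⁻¹ * T := mul_le_mul_of_nonneg_left h (by positivity)
    _ ≤ 1 := inv_mul_le_one

/-- Shifting the argument by `η` compensates for perturbing the sample, up to the fraction of
points moved by at least `η`, which Markov's inequality bounds by the mean displacement. -/
lemma ecdf_le_ecdf_add {T : ℕ} (e e' : Fin T → ℝ) {η : ℝ} (hη : 0 < η) (x : ℝ) :
    ecdf e' x ≤ ecdf e (x + η) + η⁻¹ * ((T : ℝ)⁻¹ * ∑ t, |e t - e' t|) := by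
  have h : ∑ t, (if e' t ≤ x then (1 : ℝ) else 0) ≤
      ∑ t, ((if e t ≤ x + η then (1 : ℝ) else 0) + η⁻¹ * |e t - e' t|) := by
    refine Finset.sum_le_sum fun t _ => ?_
    have hpos : 0 ≤ η⁻¹ * |e t - e' t| := by positivity
    split_ifs with h₁ h₂ h₂
    · linarith
    · have hle : η ≤ |e t - e' t| := le_trans (by linarith) (le_abs_self _)
      have : η⁻¹ * η ≤ η⁻¹ * |e t - e' t| := by gcongr
      rw [inv_mul_cancel₀ hη.ne'] at this
      linarith
    · linarith
    · linarith
  rw [Finset.sum_add_distrib, ← Finset.mul_sum] at h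
  calc ecdf e' x ≤ (T : ℝ)⁻¹ * _ := mul_le_mul_of_nonneg_left h (by positivity)
    _ = _ := by unfold ecdf; ring

lemma bddAbove_abs_ecdf_sub {T : ℕ} (e : Fin T → ℝ) {F : ℝ → ℝ}
    (hF : ∀ y, F y ∈ Set.Icc (0 : ℝ) 1) :
    BddAbove (Set.range fun y => |ecdf e y - F y|) := by
  refine ⟨1, ?_⟩
  rintro _ ⟨y, rfl⟩
  have h₀ := ecdf_nonneg e y
  have h₁ := ecdf_le_one e y
  obtain ⟨h₂, h₃⟩ := hF y
  exact abs_le.2 ⟨by linarith, by linarith⟩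


/-- Deterministic coupling of empirical CDFs of true and estimated scores (the
inequality in the proof of Lemma B.3): for real numbers `e₁,…,e_T` and
`ê₁,…,ê_T`, a nondecreasing `L`-Lipschitz `F : ℝ → [0,1]`, and any `η > 0`,
`|F̂(x) - F̃(x)| ≤ 2Lη + (1/η)·(1/T)Σ|eₜ - êₜ| + 2·sup_y |F̃(y) - F(y)|`. -/
theorem ecdf_coupling
    (T : ℕ) (hT : 1 ≤ T) (e ehat : Fin T → ℝ)
    (F : ℝ → ℝ) (L : ℝ) (hL : 0 < L)
    (hrange : ∀ y, F y ∈ Set.Icc (0 : ℝ) 1)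
    (hmono : Monotone F)
    (hLip : ∀ a b, |F a - F b| ≤ L * |a - b|)
    (η : ℝ) (hη : 0 < η) (x : ℝ) :
    |((T : ℝ)⁻¹ * ∑ t, if ehat t ≤ x then (1 : ℝ) else 0) -
        ((T : ℝ)⁻¹ * ∑ t, if e t ≤ x then (1 : ℝ) else 0)| ≤
      2 * L * η + η⁻¹ * ((T : ℝ)⁻¹ * ∑ t, |e t - ehat t|) +
        2 * ⨆ y : ℝ, |((T : ℝ)⁻¹ * ∑ t, if e t ≤ y then (1 : ℝ) else 0) - F y| := by
  change |ecdf ehat x - ecdf e x| ≤ _ + 2 * ⨆ y, |ecdf e y - F y|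
  have hsup (y : ℝ) := abs_le.1 (le_ciSup (bddAbove_abs_ecdf_sub e hrange) y)
  have hup := ecdf_le_ecdf_add e ehat hη x
  have hlo := ecdf_le_ecdf_add ehat e hη (x - η)
  simp only [sub_add_cancel, abs_sub_comm (ehat _)] at hlo
  have hF₁ := (le_abs_self _).trans (hLip (x + η) x)
  have hF₂ := (le_abs_self _).trans (hLip x (x - η))
  rw [add_sub_cancel_left, abs_of_pos hη] at hF₁
  rw [sub_sub_cancel, abs_of_pos hη] at hF₂
  have hLη : 0 < L * η := mul_pos hL hη
  obtain ⟨h₁, h₂⟩ := hsup x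
  have h₃ := (hsup (x + η)).2
  have h₄ := (hsup (x - η)).1
  exact abs_le.2 ⟨by linarith, by linarith⟩
end
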